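/- Let G be the 13 × 13 real symmetric matrix with all diagonal entries equal to 1 and off-diagonal entries (symmetrically extended) G₁₂ = −1, G₁₃ = −√2, G₂₄ = −√2, G₃₅ = −1/2, G₄₅ = −1/2, G₅₆ = −1/2, G₆₇ = −1/2, G₇₈ = −1/2, G₈₉ = −1/2, G₉,₁₀ = −1/2, G₁₀,₁₁ = −1/2, G₁₀,₁₂ = −1/2, G₁₂,₁₃ = −1/2, and all other off-diagonal entries 0. Then G has exactly 10 positive eigenvalues (with multiplicity), exactly 1 negative eigenvalue, and exactly 2 zero eigenvalues; equivalently G has rank 11 and signature (10,1). -/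

import Mathlib

open Real

noncomputable def G19 : Matrix (Fin 13) (Fin 13) ℝ :=
  !![1, -1, -(Real.sqrt 2), 0, 0, 0, 0, 0, 0, 0, 0, 0, 0;
     -1, 1, 0, -(Real.sqrt 2), 0, 0, 0, 0, 0, 0, 0, 0, 0;
     -(Real.sqrt 2), 0, 1, 0, -(1/2), 0, 0, 0, 0, 0, 0, 0, 0;
     0, -(Real.sqrt 2), 0, 1, -(1/2), 0, 0, 0, 0, 0, 0, 0, 0;
     0, 0, -(1/2), -(1/2), 1, -(1/2), 0, 0, 0, 0, 0, 0, 0;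
     0, 0, 0, 0, -(1/2), 1, -(1/2), 0, 0, 0, 0, 0, 0;
     0, 0, 0, 0, 0, -(1/2), 1, -(1/2), 0, 0, 0, 0, 0;
     0, 0, 0, 0, 0, 0, -(1/2), 1, -(1/2), 0, 0, 0, 0;
     0, 0, 0, 0, 0, 0, 0, -(1/2), 1, -(1/2), 0, 0, 0;
     0, 0, 0, 0, 0, 0, 0, 0, -(1/2), 1, -(1/2), -(1/2), 0;
     0, 0, 0, 0, 0, 0, 0, 0, 0, -(1/2), 1, 0, 0;
     0, 0, 0, 0, 0, 0, 0, 0, 0, -(1/2), 0, 1, -(1/2);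
     0, 0, 0, 0, 0, 0, 0, 0, 0, 0, 0, -(1/2), 1]

/-- Under a real congruence between diagonal matrices (not necessarily square), the number of
positive diagonal entries cannot increase. -/
theorem card_pos_le_of_transpose_mul_diagonal_mul {m n : Type*} [Fintype m] [Fintype n]
    [DecidableEq m] [DecidableEq n] {R : Matrix m n ℝ} {e : m → ℝ} {d : n → ℝ}
    (h : R.transpose * Matrix.diagonal e * R = Matrix.diagonal d) :
    (Finset.univ.filter fun i => 0 < d i).card ≤ (Finset.univ.filter fun j => 0 < e j).card := by
  classical
  let extend : ({i // 0 < d i} → ℝ) →ₗ[ℝ] n → ℝ :=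
    { toFun := fun c i => if hi : 0 < d i then c ⟨i, hi⟩ else 0
      map_add' := fun x y => by ext i; by_cases hi : 0 < d i <;> simp [hi]
      map_smul' := fun a x => by ext i; by_cases hi : 0 < d i <;> simp [hi] }
  let f : ({i // 0 < d i} → ℝ) →ₗ[ℝ] ({j // 0 < e j} → ℝ) :=
    LinearMap.funLeft ℝ ℝ Subtype.val ∘ₗ R.mulVecLin ∘ₗ extend
  have form (x : n → ℝ) : ∑ j, e j * (R.mulVec x j) ^ 2 = ∑ i, d i * x i ^ 2 := by
    have key : R.mulVec x ⬝ᵥ (Matrix.diagonal e).mulVec (R.mulVec x) =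
        x ⬝ᵥ (Matrix.diagonal d).mulVec x := by
      rw [← h, ← Matrix.mulVec_mulVec, ← Matrix.mulVec_mulVec, Matrix.dotProduct_mulVec x,
        Matrix.vecMul_transpose]
    simp only [dotProduct, Matrix.mulVec_diagonal] at key
    convert key using 2 <;> ring
  have hf : Function.Injective f := by
    rw [← LinearMap.ker_eq_bot, LinearMap.ker_eq_bot']
    intro c hc
    have nonpos : ∑ j, e j * (R.mulVec (extend c) j) ^ 2 ≤ 0 := by
      refine Finset.sum_nonpos fun j _ => ?_
      by_cases hj : 0 < e j
      · have : R.mulVec (extend c) j = 0 := congrFun hc ⟨j, hj⟩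
        simp [this]
      · exact mul_nonpos_of_nonpos_of_nonneg (not_lt.mp hj) (sq_nonneg _)
    have nonneg : ∀ i ∈ Finset.univ, 0 ≤ d i * extend c i ^ 2 := by
      intro i _
      by_cases hi : 0 < d i
      · positivity
      · simp [extend, hi]
    have vanish := (Finset.sum_eq_zero_iff_of_nonneg nonneg).mp
      (le_antisymm (form _ ▸ nonpos) (Finset.sum_nonneg nonneg))
    ext i
    simpa [extend, i.2, i.2.ne'] using vanish i (Finset.mem_univ _)
  simpa [Fintype.card_subtype] using LinearMap.finrank_le_finrank_of_injective hf

/-- **Sylvester's law of inertia** for a real symmetric matrix that is diagonalized by a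
congruence. -/
theorem card_eigenvalues_of_transpose_mul_mul_eq_diagonal {n : Type*} [Fintype n] [DecidableEq n]
    {A P : Matrix n n ℝ} (hA : A.IsHermitian) (hP : IsUnit P) {d : n → ℝ}
    (h : P.transpose * A * P = Matrix.diagonal d) :
    (Finset.univ.filter fun j => 0 < hA.eigenvalues j).card =
      (Finset.univ.filter fun i => 0 < d i).card ∧
    (Finset.univ.filter fun j => hA.eigenvalues j < 0).card =
      (Finset.univ.filter fun i => d i < 0).card := by
  set e := hA.eigenvalues with he
  obtain ⟨R, hR, hRd⟩ : ∃ R : Matrix n n ℝ, IsUnit R ∧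
      R.transpose * Matrix.diagonal e * R = Matrix.diagonal d := by
    let U : Matrix n n ℝ := hA.eigenvectorUnitary
    have spectral : A = U * Matrix.diagonal e * U.transpose := by
      have := hA.spectral_theorem
      rwa [Unitary.conjStarAlgAut_apply] at this
    refine ⟨U.transpose * P, ?_, ?_⟩
    · refine IsUnit.mul ?_ hP
      exact (Matrix.isUnit_transpose U).mpr (Unitary.isUnit_coe (U := hA.eigenvectorUnitary))
    · rw [← h]
      conv_rhs => rw [spectral]
      simp only [Matrix.transpose_mul, Matrix.transpose_transpose, Matrix.mul_assoc]
  obtain ⟨S, hS⟩ : ∃ S : Matrix n n ℝ, S.transpose * Matrix.diagonal d * S =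
      Matrix.diagonal e := by
    obtain ⟨S, hS⟩ := hR.exists_right_inv
    refine ⟨S, ?_⟩
    rw [← hRd]
    calc S.transpose * (R.transpose * Matrix.diagonal e * R) * S
        = (R * S).transpose * Matrix.diagonal e * (R * S) := by
          simp only [Matrix.transpose_mul, Matrix.mul_assoc]
      _ = Matrix.diagonal e := by simp [hS]
  have neg_congr {B : Matrix n n ℝ} {a b : n → ℝ}
      (hB : B.transpose * Matrix.diagonal a * B = Matrix.diagonal b) :
      B.transpose * Matrix.diagonal (fun i => -a i) * B = Matrix.diagonal (fun i => -b i) := by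
    have hneg (v : n → ℝ) : Matrix.diagonal (fun i => -v i) = -Matrix.diagonal v :=
      (Matrix.diagonal_neg v).symm
    rw [hneg, hneg, ← hB, Matrix.mul_neg, Matrix.neg_mul]
  refine ⟨le_antisymm (card_pos_le_of_transpose_mul_diagonal_mul hS)
    (card_pos_le_of_transpose_mul_diagonal_mul hRd), le_antisymm ?_ ?_⟩
  · simpa using card_pos_le_of_transpose_mul_diagonal_mul (neg_congr hS)
  · simpa using card_pos_le_of_transpose_mul_diagonal_mul (neg_congr hRd)

/-- The integral rescaling of `G19`: twice its conjugate by `diagonal (√2, √2, 1, …, 1)`. -/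
def G19Int : Matrix (Fin 13) (Fin 13) ℤ :=
  !![4, -4, -4, 0, 0, 0, 0, 0, 0, 0, 0, 0, 0;
     -4, 4, 0, -4, 0, 0, 0, 0, 0, 0, 0, 0, 0;
     -4, 0, 2, 0, -1, 0, 0, 0, 0, 0, 0, 0, 0;
     0, -4, 0, 2, -1, 0, 0, 0, 0, 0, 0, 0, 0;
     0, 0, -1, -1, 2, -1, 0, 0, 0, 0, 0, 0, 0;
     0, 0, 0, 0, -1, 2, -1, 0, 0, 0, 0, 0, 0;
     0, 0, 0, 0, 0, -1, 2, -1, 0, 0, 0, 0, 0;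
     0, 0, 0, 0, 0, 0, -1, 2, -1, 0, 0, 0, 0;
     0, 0, 0, 0, 0, 0, 0, -1, 2, -1, 0, 0, 0;
     0, 0, 0, 0, 0, 0, 0, 0, -1, 2, -1, -1, 0;
     0, 0, 0, 0, 0, 0, 0, 0, 0, -1, 2, 0, 0;
     0, 0, 0, 0, 0, 0, 0, 0, 0, -1, 0, 2, -1;
     0, 0, 0, 0, 0, 0, 0, 0, 0, 0, 0, -1, 2]

/-- The columns form an orthogonal basis for `G19Int`. -/
def orthogonalBasis : Matrix (Fin 13) (Fin 13) ℤ :=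
  !![0, 0, 0, 0, 0, 0, 0, 0, 1, 1, -1, -1, -1;
     0, 0, 0, 0, 0, 0, 0, 0, 0, 0, 1, 1, -1;
     0, 0, 0, 0, 0, 0, 0, 0, 0, 1, -2, -2, 0;
     0, 0, 0, 0, 0, 0, 0, 0, 0, 0, 0, 2, 0;
     0, 0, 0, 0, 0, 0, 0, 0, 0, 0, 0, 0, 4;
     0, 0, 0, 0, 0, 0, 0, 2, 0, 0, 0, 0, 8;
     0, 0, 0, 0, 0, 0, 3, 3, 0, 0, 0, 0, 12;
     0, 0, 0, 0, 0, 4, 4, 4, 0, 0, 0, 0, 16;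
     0, 0, 0, 0, 5, 5, 5, 5, 0, 0, 0, 0, 20;
     0, 0, 0, 6, 6, 6, 6, 6, 0, 0, 0, 0, 24;
     0, 0, 1, 3, 3, 3, 3, 3, 0, 0, 0, 0, 12;
     0, 2, 0, 4, 4, 4, 4, 4, 0, 0, 0, 0, 16;
     1, 1, 0, 2, 2, 2, 2, 2, 0, 0, 0, 0, 8]

/-- The inverse of `orthogonalBasis`, multiplied by 60. -/
def orthogonalBasisInv : Matrix (Fin 13) (Fin 13) ℤ :=
  !![0, 0, 0, 0, 0, 0, 0, 0, 0, 0, 0, -30, 60;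
     0, 0, 0, 0, 0, 0, 0, 0, 0, -20, 0, 30, 0;
     0, 0, 0, 0, 0, 0, 0, 0, 0, -30, 60, 0, 0;
     0, 0, 0, 0, 0, 0, 0, 0, -12, 10, 0, 0, 0;
     0, 0, 0, 0, 0, 0, 0, -15, 12, 0, 0, 0, 0;
     0, 0, 0, 0, 0, 0, -20, 15, 0, 0, 0, 0, 0;
     0, 0, 0, 0, 0, -30, 20, 0, 0, 0, 0, 0, 0;
     0, 0, 0, 0, -60, 30, 0, 0, 0, 0, 0, 0, 0;
     60, -60, -60, 0, 0, 0, 0, 0, 0, 0, 0, 0, 0;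
     0, 120, 60, 0, 30, 0, 0, 0, 0, 0, 0, 0, 0;
     0, 60, 0, -30, 15, 0, 0, 0, 0, 0, 0, 0, 0;
     0, 0, 0, 30, 0, 0, 0, 0, 0, 0, 0, 0, 0;
     0, 0, 0, 0, 15, 0, 0, 0, 0, 0, 0, 0, 0]

/-- The values of the form `G19Int` on `orthogonalBasis`. -/
def orthogonalNorms : Fin 13 → ℤ :=
  ![2, 6, 2, 30, 20, 12, 6, 2, 4, -2, 8, 0, 0]

theorem transpose_orthogonalBasis_mul_mul :
    orthogonalBasis.transpose * G19Int * orthogonalBasis = Matrix.diagonal orthogonalNorms := by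
  decide +kernel

theorem orthogonalBasis_mul_inv :
    orthogonalBasis * orthogonalBasisInv = Matrix.diagonal fun _ => 60 := by
  decide +kernel

/-- The diagonal of the rescaling that makes `2 • G19` integral. -/
noncomputable def rescaling : Fin 13 → ℝ :=
  fun i => if i.val < 2 then √2 else 1

theorem rescaling_mul_G19_mul :
    Matrix.diagonal rescaling * G19 * Matrix.diagonal rescaling =
      (1 / 2 : ℝ) • G19Int.map (Int.castRingHom ℝ) := by
  have h2 : √2 * √2 = (2 : ℝ) := Real.mul_self_sqrt (by norm_num)
  ext i j
  simp only [Matrix.mul_diagonal, Matrix.diagonal_mul, Matrix.smul_apply, Matrix.map_apply]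
  fin_cases i <;> fin_cases j <;> simp [rescaling, G19, G19Int] <;> linarith

theorem exists_isUnit_transpose_mul_G19_mul :
    ∃ P : Matrix (Fin 13) (Fin 13) ℝ, IsUnit P ∧ P.transpose * G19 * P =
      Matrix.diagonal fun i => (orthogonalNorms i : ℝ) / 2 := by
  let B : Matrix (Fin 13) (Fin 13) ℝ := orthogonalBasis.map (Int.castRingHom ℝ)
  refine ⟨Matrix.diagonal rescaling * B, IsUnit.mul ?_ ?_, ?_⟩
  · rw [Matrix.isUnit_diagonal, Pi.isUnit_iff]
    intro i
    rw [isUnit_iff_ne_zero]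
    unfold rescaling
    split_ifs <;> simp
  · have hinv := congrArg (fun X => X.map (Int.castRingHom ℝ)) orthogonalBasis_mul_inv
    simp only [Matrix.map_mul] at hinv
    rw [Matrix.diagonal_map (map_zero _)] at hinv
    refine isUnit_of_mul_isUnit_left (y := orthogonalBasisInv.map (Int.castRingHom ℝ)) ?_
    rw [hinv, Matrix.isUnit_diagonal, Pi.isUnit_iff]
    intro i
    simp
  · have hdiag := congrArg (fun X => X.map (Int.castRingHom ℝ)) transpose_orthogonalBasis_mul_mul
    simp only [Matrix.map_mul] at hdiag
    rw [Matrix.diagonal_map (map_zero _)] at hdiag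
    calc (Matrix.diagonal rescaling * B).transpose * G19 * (Matrix.diagonal rescaling * B)
        = B.transpose * (Matrix.diagonal rescaling * G19 * Matrix.diagonal rescaling) * B := by
          simp only [Matrix.transpose_mul, Matrix.diagonal_transpose, Matrix.mul_assoc]
      _ = (1 / 2 : ℝ) • (B.transpose * G19Int.map (Int.castRingHom ℝ) * B) := by
          rw [rescaling_mul_G19_mul, Matrix.mul_smul, Matrix.smul_mul]
      _ = Matrix.diagonal fun i => (orthogonalNorms i : ℝ) / 2 := by
          rw [← Matrix.transpose_map, hdiag, ← Matrix.diagonal_smul]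
          congr 1
          ext i
          simp [div_eq_inv_mul]

theorem stmt_19 (hG : G19.IsHermitian) :
    (Finset.univ.filter fun j => 0 < hG.eigenvalues j).card = 10 ∧
    (Finset.univ.filter fun j => hG.eigenvalues j < 0).card = 1 ∧
    (Finset.univ.filter fun j => hG.eigenvalues j = 0).card = 2 ∧
    G19.rank = 11 := by
  obtain ⟨P, hP, hd⟩ := exists_isUnit_transpose_mul_G19_mul
  obtain ⟨hpos, hneg⟩ := card_eigenvalues_of_transpose_mul_mul_eq_diagonal hG hP hd
  have hpos_iff (i : Fin 13) : 0 < (orthogonalNorms i : ℝ) / 2 ↔ 0 < orthogonalNorms i := by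
    rw [div_pos_iff_of_pos_right two_pos, Int.cast_pos]
  have hneg_iff (i : Fin 13) : (orthogonalNorms i : ℝ) / 2 < 0 ↔ orthogonalNorms i < 0 := by
    rw [div_lt_iff₀ two_pos, zero_mul, Int.cast_lt_zero]
  have card_pos : (Finset.univ.filter fun j => 0 < hG.eigenvalues j).card = 10 := by
    simp only [hpos, hpos_iff]
    decide +kernel
  have card_neg : (Finset.univ.filter fun j => hG.eigenvalues j < 0).card = 1 := by
    simp only [hneg, hneg_iff]
    decide +kernel
  have card_ne : (Finset.univ.filter fun j => hG.eigenvalues j ≠ 0).card = 11 := by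
    simp only [ne_iff_lt_or_gt]
    rw [Finset.filter_or, Finset.card_union_of_disjoint, card_neg, card_pos]
    exact Finset.disjoint_filter.mpr fun j _ h => not_lt.mpr h.le
  have card_eq := Finset.card_filter_add_card_filter_not (s := Finset.univ)
    fun j => hG.eigenvalues j = 0
  refine ⟨card_pos, card_neg, ?_, ?_⟩
  · simp only [Finset.card_univ, Fintype.card_fin] at card_eq
    have := card_ne
    simp only [ne_eq] at this
    omega
  · rw [hG.rank_eq_card_non_zero_eigs, Fintype.card_subtype, card_ne]
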